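/- For every n ≥ 1 there do not exist continuous functions f_1, …, f_n : S^n → ℝ, where S^n is the unit sphere in ℝ^{n+1}, such that for every x ∈ S^n and every i ∈ {1,…,n}: f_i(x) ≥ 0, f_1(x) + … + f_n(x) ≥ 1, and f_i(x)·f_i(−x) = 0. (In the paper's notation, χ(γ, a_n) > n for the antipodal action a_n of ℤ/2ℤ on S^n with γ the nonidentity element.) -/

import Mathlib

namespace ListChain

/-- Mod 2 chains on finite sequences of points of `X`; the empty sequence serves as augmentation. -/
abbrev Chain (X : Type*) := List X →₀ ZMod 2

variable {X Y : Type*}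

/-- The chain consisting of a single sequence. -/
noncomputable abbrev seq (l : List X) : Chain X := Finsupp.single l 1

theorem linearMap_ext {M : Type*} [AddCommGroup M] [Module (ZMod 2) M]
    {φ ψ : Chain X →ₗ[ZMod 2] M} (h : ∀ l, φ (seq l) = ψ (seq l)) : φ = ψ :=
  Finsupp.lhom_ext' fun l => LinearMap.ext_ring (h l)

/-- Linear extension of a map defined on sequences. -/
noncomputable abbrev extend {M : Type*} [AddCommGroup M] [Module (ZMod 2) M] (f : List X → M) :
    Chain X →ₗ[ZMod 2] M := Finsupp.linearCombination (ZMod 2) f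

theorem extend_seq {M : Type*} [AddCommGroup M] [Module (ZMod 2) M] (f : List X → M)
    (l : List X) : extend f (seq l) = f l := by
  simp [extend, seq]

/-- The cone with apex `x`. -/
noncomputable def cone (x : X) : Chain X →ₗ[ZMod 2] Chain X := extend fun l => seq (x :: l)

@[simp] theorem cone_seq (x : X) (l : List X) : cone x (seq l) = seq (x :: l) := extend_seq _ _

/-- The chain map induced by a map of points. -/
noncomputable def push (f : X → Y) : Chain X →ₗ[ZMod 2] Chain Y := extend fun l => seq (l.map f)

@[simp] theorem push_seq (f : X → Y) (l : List X) : push f (seq l) = seq (l.map f) :=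
  extend_seq _ _

/-- The boundary of a sequence: the sum of its faces. -/
noncomputable def boundarySeq : List X → Chain X
  | [] => 0
  | x :: l => seq l + cone x (boundarySeq l)

/-- The boundary operator. -/
noncomputable def boundary : Chain X →ₗ[ZMod 2] Chain X := extend boundarySeq

@[simp] theorem boundary_nil : boundary (seq ([] : List X)) = 0 := extend_seq _ _

@[simp] theorem boundary_cons (x : X) (l : List X) :
    boundary (seq (x :: l)) = seq l + cone x (boundary (seq l)) := by
  simp only [boundary, extend_seq, boundarySeq]

theorem boundary_cone (x : X) (c : Chain X) :
    boundary (cone x c) = c + cone x (boundary c) := by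
  have : boundary ∘ₗ cone x = LinearMap.id + cone x ∘ₗ boundary :=
    linearMap_ext fun l => by simp
  exact LinearMap.congr_fun this c

theorem boundary_boundary (c : Chain X) : boundary (boundary c) = 0 := by
  have : (boundary ∘ₗ boundary : Chain X →ₗ[ZMod 2] Chain X) = 0 :=
    linearMap_ext fun l => by
      induction l with
      | nil => simp
      | cons x l ih =>
        have ih' : boundary (boundary (seq l)) = 0 := ih
        simp [boundary_cone, ih', ZModModule.add_self]
  exact LinearMap.congr_fun this c

theorem push_cone (f : X → Y) (x : X) (c : Chain X) :
    push f (cone x c) = cone (f x) (push f c) := by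
  have : push f ∘ₗ cone x = cone (f x) ∘ₗ push f := linearMap_ext fun l => by simp
  exact LinearMap.congr_fun this c

theorem boundary_push (f : X → Y) (c : Chain X) :
    boundary (push f c) = push f (boundary c) := by
  have : boundary ∘ₗ push f = push f ∘ₗ boundary :=
    linearMap_ext fun l => by
      induction l with
      | nil => simp
      | cons x l ih =>
        have ih' : boundary (push f (seq l)) = push f (boundary (seq l)) := ih
        rw [push_seq] at ih'
        simp [push_cone, ih']
  exact LinearMap.congr_fun this c

theorem push_push_of_involutive {f : X → X} (hf : Function.Involutive f) (c : Chain X) :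
    push f (push f c) = c := by
  have : push f ∘ₗ push f = LinearMap.id :=
    linearMap_ext fun l => by simp [hf.comp_self]
  exact LinearMap.congr_fun this c

/-- The prism between the images of a sequence under two maps. -/
noncomputable def prismSeq (f g : X → Y) : List X → Chain Y
  | [] => 0
  | x :: l => seq (f x :: g x :: l.map g) + cone (f x) (prismSeq f g l)

/-- The prism operator, a chain homotopy between `push f` and `push g`. -/
noncomputable def prism (f g : X → Y) : Chain X →ₗ[ZMod 2] Chain Y := extend (prismSeq f g)

theorem prism_nil (f g : X → Y) : prism f g (seq []) = 0 := extend_seq _ _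

theorem prism_cons (f g : X → Y) (x : X) (l : List X) :
    prism f g (seq (x :: l)) =
      seq (f x :: g x :: l.map g) + cone (f x) (prism f g (seq l)) := by
  simp only [prism, extend_seq, prismSeq]

theorem prism_cone (f g : X → Y) (x : X) (c : Chain X) :
    prism f g (cone x c) =
      cone (f x) (cone (g x) (push g c)) + cone (f x) (prism f g c) := by
  have : prism f g ∘ₗ cone x =
      cone (f x) ∘ₗ cone (g x) ∘ₗ push g + cone (f x) ∘ₗ prism f g :=
    linearMap_ext fun l => by simp [prism_cons]
  exact LinearMap.congr_fun this c

theorem boundary_prism (f g : X → Y) (c : Chain X) :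
    boundary (prism f g c) + prism f g (boundary c) = push f c + push g c := by
  have : boundary ∘ₗ prism f g + prism f g ∘ₗ boundary = push f + push g :=
    linearMap_ext fun l => by
      induction l with
      | nil => simp [prism_nil, ZModModule.add_self]
      | cons x l ih =>
        have ih' : boundary (prism f g (seq l)) =
            seq (l.map f) + seq (l.map g) - prism f g (boundary (seq l)) := by
          rw [eq_sub_iff_add_eq]
          simpa using ih
        have hb : boundary (seq (l.map g)) = push g (boundary (seq l)) := by
          rw [← boundary_push, push_seq]
        simp only [LinearMap.add_apply, LinearMap.comp_apply, prism_cons, map_add, boundary_cons,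
          boundary_cone, prism_cone, ih', hb, push_seq, List.map_cons, cone_seq,
          ZModModule.sub_eq_add]
        have h2 : ∀ u : Chain Y, u + u = 0 := ZModModule.add_self
        have e1 := h2 (seq (f x :: l.map g))
        have e2 := h2 (cone (f x) (cone (g x) (push g (boundary (seq l)))))
        have e3 := h2 (cone (f x) (prism f g (boundary (seq l))))
        have e4 := h2 (prism f g (seq l))
        linear_combination (norm := module) e1 + e2 + e3 + e4
  exact LinearMap.congr_fun this c

/-- The prism on `l` is a sum of sequences of points of the images of `l` under `f` and `g`. -/
theorem prism_seq_mem_span (f g : X → Y) (l : List X) :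
    prism f g (seq l) ∈ Submodule.span (ZMod 2)
      (seq '' {m : List Y | ∀ y ∈ m, ∃ x ∈ l, y = f x ∨ y = g x}) := by
  induction l with
  | nil => simp [prism_nil]
  | cons x l ih =>
    rw [prism_cons]
    refine Submodule.add_mem _ (Submodule.subset_span ⟨_, ?_, rfl⟩) ?_
    · intro y hy
      simp only [List.mem_cons, List.mem_map] at hy ⊢
      rcases hy with rfl | rfl | ⟨z, hz, rfl⟩
      · exact ⟨x, by simp⟩
      · exact ⟨x, by simp⟩
      · exact ⟨z, by simp [hz]⟩
    · rw [← Submodule.mem_comap]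
      refine Submodule.span_le.2 ?_ ih
      rintro _ ⟨m, hm, rfl⟩
      rw [SetLike.mem_coe, Submodule.mem_comap, cone_seq]
      refine Submodule.subset_span ⟨_, ?_, rfl⟩
      intro y hy
      rcases List.mem_cons.1 hy with rfl | hy
      · exact ⟨x, by simp⟩
      · obtain ⟨z, hz, h⟩ := hm y hy
        exact ⟨z, by simp [hz], h⟩

/-- Multiply a cochain by the value of `a` at the first point. -/
noncomputable def headMul (a : X → ZMod 2) (φ : Chain X →ₗ[ZMod 2] ZMod 2) :
    Chain X →ₗ[ZMod 2] ZMod 2 :=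
  extend fun l => (l.head?.elim 0 a) * φ (seq l)

theorem headMul_seq_cons (a : X → ZMod 2) (φ : Chain X →ₗ[ZMod 2] ZMod 2) (x : X) (l : List X) :
    headMul a φ (seq (x :: l)) = a x * φ (seq (x :: l)) := extend_seq _ _

theorem headMul_seq_nil (a : X → ZMod 2) (φ : Chain X →ₗ[ZMod 2] ZMod 2) :
    headMul a φ (seq []) = 0 := by
  simp only [headMul, extend_seq]
  simp

theorem headMul_cone (a : X → ZMod 2) (φ : Chain X →ₗ[ZMod 2] ZMod 2) (x : X) (c : Chain X) :
    headMul a φ (cone x c) = a x * φ (cone x c) := by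
  have : headMul a φ ∘ₗ cone x = a x • (φ ∘ₗ cone x) :=
    linearMap_ext fun l => by simp [headMul_seq_cons]
  exact LinearMap.congr_fun this c

/-- The cup product of the coboundaries of the given functions. -/
noncomputable def cup : List (X → ZMod 2) → (Chain X →ₗ[ZMod 2] ZMod 2)
  | [] => extend fun l => if l.length = 1 then 1 else 0
  | a :: as => headMul a (cup as) ∘ₗ boundary

theorem cup_nil_seq (l : List X) : cup [] (seq l) = if l.length = 1 then 1 else 0 :=
  extend_seq _ _

theorem cup_cons (a : X → ZMod 2) (as : List (X → ZMod 2)) (c : Chain X) :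
    cup (a :: as) c = headMul a (cup as) (boundary c) := rfl

theorem cup_empty (as : List (X → ZMod 2)) : cup as (seq ([] : List X)) = 0 := by
  cases as with
  | nil => simp [cup_nil_seq]
  | cons a as => simp [cup_cons]

theorem cup_boundary (as : List (X → ZMod 2)) (c : Chain X) : cup as (boundary c) = 0 := by
  cases as with
  | cons a as => simp [cup_cons, boundary_boundary]
  | nil =>
    have : cup [] ∘ₗ (boundary : Chain X →ₗ[ZMod 2] Chain X) = 0 := linearMap_ext fun l => by
      match l with
      | [] => simp
      | [x] => simp [cup_nil_seq]
      | [x, y] => simp [cup_nil_seq, ZModModule.add_self]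
      | x :: y :: z :: l =>
        have hc (x y : X) (c : Chain X) : cup [] (cone x (cone y c)) = 0 := by
          have : cup [] ∘ₗ cone x ∘ₗ cone y = 0 :=
            linearMap_ext fun l => by simp [cup_nil_seq]
          exact LinearMap.congr_fun this c
        simp [cup_nil_seq, hc]
    exact LinearMap.congr_fun this c

theorem cup_cons_seq (a : X → ZMod 2) (as : List (X → ZMod 2)) (x y : X) (l : List X) :
    cup (a :: as) (seq (x :: y :: l)) = (a x + a y) * cup as (seq (y :: l)) := by
  have h := cup_boundary as (seq (x :: y :: l))
  rw [boundary_cons, map_add] at h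
  rw [cup_cons, boundary_cons, map_add, headMul_seq_cons, headMul_cone,
    ← ZModModule.neg_eq_self (cup as (cone x _)), ← eq_neg_of_add_eq_zero_left h]
  ring

theorem cup_eq_zero {as : List (X → ZMod 2)} {a : X → ZMod 2} (ha : a ∈ as) {l : List X}
    (hl : ∀ x ∈ l, ∀ y ∈ l, a x = a y) : cup as (seq l) = 0 := by
  induction as generalizing l with
  | nil => simp at ha
  | cons b as ih =>
    match l with
    | [] => exact cup_empty _
    | [x] => simp [cup_cons, headMul_seq_nil]
    | x :: y :: l =>
      rw [cup_cons_seq]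
      rcases List.mem_cons.1 ha with rfl | h
      · rw [hl x (by simp) y (by simp), ZModModule.add_self, zero_mul]
      · rw [ih h fun u hu v hv => hl u (List.mem_cons_of_mem _ hu) v (List.mem_cons_of_mem _ hv),
          mul_zero]

theorem headMul_push {T : X → X} {a : X → ZMod 2} (ha : ∀ x, a (T x) = a x + 1)
    {φ : Chain X →ₗ[ZMod 2] ZMod 2} (h0 : φ (seq []) = 0) (hφ : ∀ c, φ (push T c) = φ c)
    (c : Chain X) : headMul a φ (push T c) = headMul a φ c + φ c := by
  have : headMul a φ ∘ₗ push T = headMul a φ + φ := linearMap_ext fun l => by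
    cases l with
    | nil => simp [headMul_seq_nil, h0]
    | cons x l =>
      have := hφ (seq (x :: l))
      rw [push_seq, List.map_cons] at this
      simp only [LinearMap.add_apply, LinearMap.comp_apply, push_seq, List.map_cons,
        headMul_seq_cons, ha, this]
      ring
  exact LinearMap.congr_fun this c

theorem cup_push {T : X → X} {as : List (X → ZMod 2)} (has : ∀ a ∈ as, ∀ x, a (T x) = a x + 1)
    (c : Chain X) : cup as (push T c) = cup as c := by
  induction as generalizing c with
  | nil =>
    have : cup [] ∘ₗ push T = cup [] := linearMap_ext fun l => by simp [cup_nil_seq]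
    exact LinearMap.congr_fun this c
  | cons a as ih =>
    rw [cup_cons, cup_cons, boundary_push, headMul_push (has a (by simp)) (cup_empty as)
      (ih fun b hb => has b (by simp [hb])), cup_boundary, add_zero]

theorem cup_cons_of_boundary_eq {T : X → X} {a : X → ZMod 2} {as : List (X → ZMod 2)}
    (has : ∀ b ∈ a :: as, ∀ x, b (T x) = b x + 1) {c w : Chain X}
    (hw : boundary w = c + push T c) : cup (a :: as) w = cup as c := by
  rw [cup_cons, hw, map_add, headMul_push (has a (by simp)) (cup_empty as)
      (cup_push fun b hb => has b (by simp [hb])), ← add_assoc, ZModModule.add_self, zero_add]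

section Metric

variable [PseudoMetricSpace X] [PseudoMetricSpace Y]

/-- Sequences of points of `D` with mutual distances less than `ε`. -/
def FineSeq (D : Set X) (ε : ℝ) : Set (List X) :=
  {l | (∀ x ∈ l, x ∈ D) ∧ ∀ x ∈ l, ∀ y ∈ l, dist x y < ε}

/-- Chains made of sequences of points of `D` with mutual distances less than `ε`. -/
noncomputable def fineChain (D : Set X) (ε : ℝ) : Submodule (ZMod 2) (Chain X) :=
  Submodule.span (ZMod 2) (seq '' FineSeq D ε)

theorem seq_mem_fineChain {D : Set X} {ε : ℝ} {l : List X} (hl : l ∈ FineSeq D ε) :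
    seq l ∈ fineChain D ε := Submodule.subset_span ⟨l, hl, rfl⟩

theorem fineChain_mono {D D' : Set X} {ε ε' : ℝ} (hD : D ⊆ D') (hε : ε ≤ ε') :
    fineChain D ε ≤ fineChain D' ε' :=
  Submodule.span_mono <| Set.image_mono fun _ hl =>
    ⟨fun x hx => hD (hl.1 x hx), fun x hx y hy => (hl.2 x hx y hy).trans_le hε⟩

theorem map_mem_of_mem_fineChain {M : Type*} [AddCommGroup M] [Module (ZMod 2) M] {D : Set X}
    {ε : ℝ} {φ : Chain X →ₗ[ZMod 2] M} {S : Submodule (ZMod 2) M}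
    (h : ∀ l ∈ FineSeq D ε, φ (seq l) ∈ S) {c : Chain X} (hc : c ∈ fineChain D ε) : φ c ∈ S := by
  have : fineChain D ε ≤ S.comap φ := Submodule.span_le.2 <| by
    rintro _ ⟨l, hl, rfl⟩
    exact h l hl
  exact this hc

theorem push_mem_fineChain {f : X → Y} {D : Set X} {D' : Set Y} {δ ε : ℝ}
    (hf : Set.MapsTo f D D') (hd : ∀ x ∈ D, ∀ y ∈ D, dist x y < δ → dist (f x) (f y) < ε)
    {c : Chain X} (hc : c ∈ fineChain D δ) : push f c ∈ fineChain D' ε :=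
  map_mem_of_mem_fineChain (fun l hl => by
    rw [push_seq]
    refine seq_mem_fineChain ⟨?_, ?_⟩
    · simpa using fun x hx => hf (hl.1 x hx)
    · simpa using fun x hx y hy => hd x (hl.1 x hx) y (hl.1 y hy) (hl.2 x hx y hy)) hc

theorem prism_mem_fineChain {f g : X → Y} {D : Set X} {D' : Set Y} {δ ε : ℝ}
    (hf : Set.MapsTo f D D') (hg : Set.MapsTo g D D')
    (hff : ∀ x ∈ D, ∀ y ∈ D, dist x y < δ → dist (f x) (f y) < ε)
    (hgg : ∀ x ∈ D, ∀ y ∈ D, dist x y < δ → dist (g x) (g y) < ε)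
    (hfg : ∀ x ∈ D, ∀ y ∈ D, dist x y < δ → dist (f x) (g y) < ε)
    {c : Chain X} (hc : c ∈ fineChain D δ) : prism f g c ∈ fineChain D' ε := by
  refine map_mem_of_mem_fineChain (fun l hl => ?_) hc
  refine Submodule.span_mono (Set.image_mono ?_) (prism_seq_mem_span f g l)
  intro m hm
  refine ⟨fun y hy => ?_, fun y hy z hz => ?_⟩
  · obtain ⟨x, hx, rfl | rfl⟩ := hm y hy
    exacts [hf (hl.1 x hx), hg (hl.1 x hx)]
  · obtain ⟨x, hx, h⟩ := hm y hy
    obtain ⟨x', hx', h'⟩ := hm z hz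
    have hd := hl.2 x hx x' hx'
    have hd' := hl.2 x' hx' x hx
    rcases h with rfl | rfl <;> rcases h' with rfl | rfl
    · exact hff x (hl.1 x hx) x' (hl.1 x' hx') hd
    · exact hfg x (hl.1 x hx) x' (hl.1 x' hx') hd
    · rw [dist_comm]
      exact hfg x' (hl.1 x' hx') x (hl.1 x hx) hd'
    · exact hgg x (hl.1 x hx) x' (hl.1 x' hx') hd

/-- In a compact set with a contraction to a point, fine cycles bound fine chains. -/
theorem exists_fineChain_boundary_eq {D : Set X} (hD : IsCompact D) {p : X} (hp : p ∈ D)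
    {H : ℝ → X → X} (hH : ContinuousOn (fun q : ℝ × X => H q.1 q.2) (Set.Icc 0 1 ×ˢ D))
    (hmaps : ∀ t ∈ Set.Icc (0 : ℝ) 1, Set.MapsTo (H t) D D) (h0 : ∀ x, H 0 x = x)
    (h1 : ∀ x, H 1 x = p) {ε : ℝ} (hε : 0 < ε) :
    ∃ δ > 0, ∀ z ∈ fineChain D δ, boundary z = 0 → ∃ w ∈ fineChain D ε, boundary w = z := by
  have hu := (isCompact_Icc.prod hD).uniformContinuousOn_of_continuous hH
  obtain ⟨δ, hδ, hdist⟩ := Metric.uniformContinuousOn_iff.1 hu ε hε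
  refine ⟨δ, hδ, fun z hz hz0 => ?_⟩
  obtain ⟨N, hN⟩ := exists_nat_one_div_lt hδ
  have hN0 : (0 : ℝ) < N + 1 := by positivity
  set τ : ℕ → ℝ := fun j => j / (N + 1) with hτ
  have hτmem : ∀ j ≤ N + 1, τ j ∈ Set.Icc (0 : ℝ) 1 := fun j hj => by
    refine ⟨by positivity, ?_⟩
    rw [hτ, div_le_one hN0]
    exact_mod_cast hj
  have hclose : ∀ s ∈ Set.Icc (0 : ℝ) 1, ∀ t ∈ Set.Icc (0 : ℝ) 1, dist s t < δ →
      ∀ x ∈ D, ∀ y ∈ D, dist x y < δ → dist (H s x) (H t y) < ε := by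
    intro s hs t ht hst x hx y hy hxy
    exact hdist (s, x) ⟨hs, hx⟩ (t, y) ⟨ht, hy⟩ (by rw [Prod.dist_eq]; exact max_lt hst hxy)
  have hstep : ∀ j ≤ N + 1, ∃ w ∈ fineChain D ε, boundary w = z + push (H (τ j)) z := by
    intro j
    induction j with
    | zero =>
      intro _
      refine ⟨0, Submodule.zero_mem _, ?_⟩
      have : push (H (τ 0)) = LinearMap.id := linearMap_ext fun l => by
        have : H (τ 0) = id := by
          funext x
          simp [hτ, h0]
        simp [this]
      rw [this, map_zero, LinearMap.id_apply, ZModModule.add_self]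
    | succ j ih =>
      intro hj
      obtain ⟨w, hw, hwb⟩ := ih (by omega)
      have hj0 := hτmem j (by omega)
      have hj1 := hτmem (j + 1) hj
      have hjj : dist (τ j) (τ (j + 1)) < δ := by
        have : τ j - τ (j + 1) = -(1 / (N + 1)) := by
          simp only [hτ]
          push_cast
          field_simp
          ring
        rw [Real.dist_eq, this, abs_neg, abs_of_pos (by positivity)]
        exact hN
      refine ⟨w + prism (H (τ j)) (H (τ (j + 1))) z, Submodule.add_mem _ hw
        (prism_mem_fineChain (hmaps _ hj0) (hmaps _ hj1)
          (hclose _ hj0 _ hj0 (by simpa using hδ)) (hclose _ hj1 _ hj1 (by simpa using hδ))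
          (hclose _ hj0 _ hj1 hjj) hz), ?_⟩
      have hb := boundary_prism (H (τ j)) (H (τ (j + 1))) z
      rw [hz0, map_zero, add_zero] at hb
      rw [map_add, hwb, hb, add_assoc, ← add_assoc (push (H (τ j)) z), ZModModule.add_self,
        zero_add]
  obtain ⟨w, hw, hwb⟩ := hstep (N + 1) le_rfl
  have hτ1 : τ (N + 1) = 1 := by
    simp only [hτ]
    push_cast
    exact div_self hN0.ne'
  rw [hτ1] at hwb
  refine ⟨w + cone p (push (H 1) z), Submodule.add_mem _ hw ?_, ?_⟩
  · refine map_mem_of_mem_fineChain (φ := cone p ∘ₗ push (H 1)) (fun l _ => ?_) hz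
    rw [LinearMap.comp_apply, push_seq, cone_seq]
    have hall : ∀ x ∈ p :: l.map (H 1), x = p := by simp [h1]
    refine seq_mem_fineChain ⟨fun x hx => hall x hx ▸ hp, fun x hx y hy => ?_⟩
    rw [hall x hx, hall y hy, dist_self]
    exact hε
  · rw [map_add, hwb, boundary_cone, boundary_push, hz0, map_zero, map_zero, add_zero, add_assoc,
      ZModModule.add_self, add_zero]

end Metric

end ListChain

namespace EuclideanSphere

open ListChain

variable {n : ℕ}

/-- The unit sphere in `ℝ^(n+1)`. -/
abbrev Sph (n : ℕ) := Metric.sphere (0 : EuclideanSpace ℝ (Fin (n + 1))) 1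

/-- The `k`-th standard basis vector as a point of the sphere. -/
noncomputable def pole (k : Fin (n + 1)) : Sph n :=
  ⟨EuclideanSpace.single k 1, by simp⟩

/-- The upper hemisphere of the `k`-dimensional coordinate subsphere. -/
def hemisphere (k : Fin (n + 1)) : Set (Sph n) :=
  {x | (∀ j, k < j → x.1 j = 0) ∧ 0 ≤ x.1 k}

open Classical in
/-- Radial projection to the sphere. -/
noncomputable def radial (v : EuclideanSpace ℝ (Fin (n + 1))) : Sph n :=
  if h : v = 0 then pole 0 else ⟨‖v‖⁻¹ • v, by simp [norm_smul, h]⟩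

theorem radial_coe {v : EuclideanSpace ℝ (Fin (n + 1))} (h : v ≠ 0) :
    (radial v : EuclideanSpace ℝ (Fin (n + 1))) = ‖v‖⁻¹ • v := by
  simp [radial, h]

theorem radial_self (x : Sph n) : radial (x : EuclideanSpace ℝ (Fin (n + 1))) = x := by
  have hx : ‖(x : EuclideanSpace ℝ (Fin (n + 1)))‖ = 1 := norm_eq_of_mem_sphere x
  ext1
  rw [radial_coe (by rintro h; simp [h] at hx), hx, inv_one, one_smul]

theorem continuousOn_radial :
    ContinuousOn (radial : EuclideanSpace ℝ (Fin (n + 1)) → Sph n) {0}ᶜ := by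
  rw [Topology.IsInducing.subtypeVal.continuousOn_iff]
  have : ContinuousOn (fun v : EuclideanSpace ℝ (Fin (n + 1)) => ‖v‖⁻¹ • v) {0}ᶜ :=
    (continuousOn_id.norm.inv₀ fun v hv => norm_ne_zero_iff.2 hv).smul continuousOn_id
  exact this.congr fun v hv => radial_coe hv

/-- The segment from a point of the sphere to the `k`-th pole. -/
noncomputable def segmentTo (k : Fin (n + 1)) (t : ℝ) (x : Sph n) :
    EuclideanSpace ℝ (Fin (n + 1)) :=
  (1 - t) • (x : EuclideanSpace ℝ (Fin (n + 1))) + t • (pole k : EuclideanSpace ℝ (Fin (n + 1)))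

theorem segmentTo_apply_self (k : Fin (n + 1)) (t : ℝ) (x : Sph n) :
    segmentTo k t x k = (1 - t) * x.1 k + t := by
  simp [segmentTo, pole]

theorem segmentTo_apply_of_ne {k j : Fin (n + 1)} (h : j ≠ k) (t : ℝ) (x : Sph n) :
    segmentTo k t x j = (1 - t) * x.1 j := by
  simp [segmentTo, pole, h]

theorem segmentTo_ne_zero {k : Fin (n + 1)} {t : ℝ} (ht : t ∈ Set.Icc (0 : ℝ) 1) {x : Sph n}
    (hx : x ∈ hemisphere k) : segmentTo k t x ≠ 0 := by
  intro h
  have hk : (1 - t) * x.1 k + t = 0 := by rw [← segmentTo_apply_self, h]; rfl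
  have ht0 : t = 0 := by
    have := mul_nonneg (sub_nonneg.2 ht.2) hx.2
    linarith [ht.1]
  have hx1 : ‖(x : EuclideanSpace ℝ (Fin (n + 1)))‖ = 1 := norm_eq_of_mem_sphere x
  have hx0 : (x : EuclideanSpace ℝ (Fin (n + 1))) = 0 := by
    simpa [segmentTo, ht0] using h
  simp [hx0] at hx1

theorem isCompact_hemisphere (k : Fin (n + 1)) : IsCompact (hemisphere k) := by
  have hc (j : Fin (n + 1)) : Continuous fun x : Sph n => x.1 j := by fun_prop
  have heq : hemisphere k = (⋂ j, ⋂ (_ : k < j), {x : Sph n | x.1 j = 0}) ∩ {x | 0 ≤ x.1 k} := by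
    ext x
    simp [hemisphere]
  rw [heq]
  refine IsClosed.isCompact (IsClosed.inter ?_ (isClosed_le continuous_const (hc k)))
  exact isClosed_iInter fun j => isClosed_iInter fun _ => isClosed_eq (hc j) continuous_const

theorem pole_mem_hemisphere (k : Fin (n + 1)) : pole k ∈ hemisphere k :=
  ⟨fun j hj => by simp [pole, hj.ne'], by simp [pole]⟩

theorem mapsTo_radial_segmentTo (k : Fin (n + 1)) {t : ℝ} (ht : t ∈ Set.Icc (0 : ℝ) 1) :
    Set.MapsTo (fun x => radial (segmentTo k t x)) (hemisphere k) (hemisphere k) := by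
  intro x hx
  have hne := segmentTo_ne_zero ht hx
  refine ⟨fun j hj => ?_, ?_⟩
  · rw [radial_coe hne, PiLp.smul_apply, segmentTo_apply_of_ne hj.ne', hx.1 j hj]
    simp
  · rw [radial_coe hne, PiLp.smul_apply, segmentTo_apply_self, smul_eq_mul]
    exact mul_nonneg (by positivity)
      (add_nonneg (mul_nonneg (sub_nonneg.2 ht.2) hx.2) ht.1)

/-- Fine cycles in a hemisphere bound fine chains. -/
theorem exists_fineChain_hemisphere (k : Fin (n + 1)) {ε : ℝ} (hε : 0 < ε) :
    ∃ δ > 0, ∀ z ∈ fineChain (hemisphere k) δ, boundary z = 0 →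
      ∃ w ∈ fineChain (hemisphere k) ε, boundary w = z := by
  refine exists_fineChain_boundary_eq (isCompact_hemisphere k) (pole_mem_hemisphere k)
    (H := fun t x => radial (segmentTo k t x)) ?_ (fun t ht => mapsTo_radial_segmentTo k ht)
    (fun x => by simp [segmentTo, radial_self]) (fun x => by simp [segmentTo, radial_self]) hε
  refine continuousOn_radial.comp (t := {0}ᶜ)
    (f := fun q : ℝ × Sph n => segmentTo k q.1 q.2) ?_ ?_
  · unfold segmentTo
    fun_prop
  · rintro ⟨t, x⟩ ⟨ht, hx⟩
    exact segmentTo_ne_zero ht hx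

/-- A fine chain on a hemisphere of dimension `k`, bounded by an antipodally symmetric cycle, on
which every `k`-fold cup product of coboundaries of odd functions takes the value `1`. -/
theorem exists_fineChain_cup_eq_one (k : ℕ) (hk : k < n + 1) {ε : ℝ} (hε : 0 < ε) :
    ∃ c ∈ fineChain (hemisphere (⟨k, hk⟩ : Fin (n + 1))) ε,
      boundary (c + push Neg.neg c) = 0 ∧
      ∀ as : List (Sph n → ZMod 2), as.length = k → (∀ a ∈ as, ∀ x, a (-x) = a x + 1) →
        cup as c = 1 := by
  induction k generalizing ε with
  | zero =>
    refine ⟨seq [pole 0], seq_mem_fineChain ⟨by simp [pole_mem_hemisphere], by simpa using hε⟩,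
      by simp [ZModModule.add_self], fun as has _ => ?_⟩
    rw [List.length_eq_zero_iff.1 has, cup_nil_seq]
    simp
  | succ k ih =>
    obtain ⟨δ, hδ, hfill⟩ := exists_fineChain_hemisphere (⟨k + 1, hk⟩ : Fin (n + 1)) hε
    obtain ⟨c, hc, hcb, hcup⟩ := ih (by omega) hδ
    have hlt : (⟨k, by omega⟩ : Fin (n + 1)) < ⟨k + 1, hk⟩ := Nat.lt_succ_self k
    have hsub : hemisphere (⟨k, by omega⟩ : Fin (n + 1)) ⊆ hemisphere ⟨k + 1, hk⟩ :=
      fun x hx => ⟨fun j hj => hx.1 j (hlt.trans hj), (hx.1 _ hlt).ge⟩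
    have hneg : Set.MapsTo (Neg.neg : Sph n → Sph n) (hemisphere ⟨k, by omega⟩)
        (hemisphere ⟨k + 1, hk⟩) := fun x hx =>
      ⟨fun j hj => by simp [hx.1 j (hlt.trans hj)], by simp [hx.1 _ hlt]⟩
    obtain ⟨w, hw, hwb⟩ := hfill (c + push Neg.neg c) (Submodule.add_mem _
      (fineChain_mono hsub le_rfl hc) (push_mem_fineChain hneg (fun x _ y _ h => by
        rwa [Subtype.dist_eq, coe_neg_sphere, coe_neg_sphere, dist_neg_neg]) hc)) hcb
    refine ⟨w, hw, ?_, ?_⟩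
    · rw [map_add, boundary_push, hwb, map_add, push_push_of_involutive neg_involutive,
        add_comm c, ZModModule.add_self]
    · intro as has hodd
      obtain ⟨a, as, rfl⟩ := List.exists_cons_of_length_eq_add_one has
      rw [cup_cons_of_boundary_eq hodd hwb]
      exact hcup as (by simpa using has) fun b hb => hodd b (by simp [hb])

theorem exists_odd_zmod_two (n : ℕ) : ∃ h : Sph n → ZMod 2, ∀ x, h (-x) = h x + 1 := by
  classical
  let _ : LinearOrder (Sph n) := linearOrderOfSTO WellOrderingRel
  refine ⟨fun x => if x < -x then 1 else 0, fun x => ?_⟩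
  have hne : x ≠ -x := ne_neg_of_mem_unit_sphere ℝ x
  rcases lt_or_gt_of_ne hne with h | h
  · simp [h, h.not_gt, CharTwo.add_self_eq_zero]
  · simp [h, h.not_gt]

/-- A function separating `{f > 0}` from its antipode extends to an odd `ZMod 2`-valued one. -/
theorem exists_odd_eq_one_of_pos {f : Sph n → ℝ} (hf : ∀ x, f x * f (-x) = 0) :
    ∃ a : Sph n → ZMod 2, (∀ x, a (-x) = a x + 1) ∧ ∀ x, 0 < f x → a x = 1 := by
  classical
  obtain ⟨h, hh⟩ := exists_odd_zmod_two n
  refine ⟨fun x => if 0 < f x then 1 else if 0 < f (-x) then 0 else h x, fun x => ?_,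
    fun x hx => by simp [hx]⟩
  have := hf x
  by_cases h1 : 0 < f x <;> by_cases h2 : 0 < f (-x)
  · exact absurd this (mul_pos h1 h2).ne'
  · simp [h1, h2, CharTwo.add_self_eq_zero]
  · simp [h1, h2]
  · simp [h1, h2, hh]

end EuclideanSphere

/-- (Borsuk–Ulam type statement.) For `n ≥ 1` there are no continuous functions
`f_1, …, f_n : S^n → ℝ` with `f_i ≥ 0`, `f_1 + … + f_n ≥ 1` pointwise, and
`f_i(x) · f_i(−x) = 0` for all `x ∈ S^n`; i.e. `χ(γ, a_n) > n` for the antipodal action. -/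
theorem stmt3 (n : ℕ) (hn : 1 ≤ n) :
    ¬ ∃ f : Fin n → (Metric.sphere (0 : EuclideanSpace ℝ (Fin (n + 1))) 1 → ℝ),
        (∀ i, Continuous (f i)) ∧
        (∀ i x, 0 ≤ f i x) ∧
        (∀ x, 1 ≤ ∑ i, f i x) ∧
        (∀ i x, f i x * f i (-x) = 0) := by
  rintro ⟨f, hcont, -, hsum, hmul⟩
  have hcover : Set.univ ⊆ ⋃ i, {x | 0 < f i x} := fun x _ => by
    by_contra hx
    simp only [Set.mem_iUnion, Set.mem_ofPred_eq, not_exists, not_lt] at hx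
    linarith [hsum x, Finset.sum_nonpos fun i (_ : i ∈ Finset.univ) => hx i]
  obtain ⟨δ, hδ, hball⟩ := lebesgue_number_lemma_of_metric isCompact_univ
    (fun i => isOpen_lt continuous_const (hcont i)) hcover
  choose a hodd hone using fun i => EuclideanSphere.exists_odd_eq_one_of_pos (hmul i)
  obtain ⟨c, hc, -, hcup⟩ :=
    EuclideanSphere.exists_fineChain_cup_eq_one n (Nat.lt_succ_self n) hδ
  have h1 := hcup (List.ofFn a) (by simp) (by simpa [List.mem_ofFn] using hodd)
  have h0 : ListChain.cup (List.ofFn a) c ∈ (⊥ : Submodule (ZMod 2) (ZMod 2)) := by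
    refine ListChain.map_mem_of_mem_fineChain (fun l hl => ?_) hc
    rw [Submodule.mem_bot]
    cases l with
    | nil => exact ListChain.cup_empty _
    | cons x l =>
      obtain ⟨i, hi⟩ := hball x (Set.mem_univ x)
      have hval : ∀ y ∈ x :: l, a i y = 1 := fun y hy =>
        hone i y (hi (hl.2 y hy x (by simp)))
      exact ListChain.cup_eq_zero (List.mem_ofFn.2 ⟨i, rfl⟩)
        fun y hy z hz => (hval y hy).trans (hval z hz).symm
  rw [Submodule.mem_bot, h1] at h0
  exact one_ne_zero h0
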